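/- arXiv:0709.4107 — 2 statements merged into one kernel-verified Lean document; each statement's English description precedes it below -/
import Mathlib

section
/- Let A be a commutative complex Banach algebra with unit, and let a be an orthogonal unit of the Wiener algebra W(A) with associated idempotent family {Π_n}_{n∈ℤ}. Then the element a(1) := Σ_{n∈ℤ} a(n) (the sum converging absolutely in A) is a unit of A, the function N : ℤ → A with N(n) = Π_n is an orthonormal unit of W(A), and a(n) = a(1)·Π_n for all n ∈ ℤ. Moreover this decomposition is unique: if a(n) = u·M(n) for all n, where u is a unit of A and M is an orthonormal element of W(A), then u = a(1) and M(n) = Π_n for all n. -/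
open scoped BigOperators

/-- A function `a : ℤ → A` is rapidly decreasing if for every `k` the quantities
`(1+|n|)^k * ‖a n‖` are bounded. -/
def RapidlyDecreasing {A : Type*} [NormedRing A] (a : ℤ → A) : Prop :=
  ∀ k : ℕ, ∃ C : ℝ, ∀ n : ℤ, (1 + |(n : ℝ)|) ^ k * ‖a n‖ ≤ C

/-- The convolution product of the Wiener algebra `W(A)`:
`(a*b)(n) = ∑_{m∈ℤ} a(m)·b(n−m)`. -/
noncomputable def conv {A : Type*} [NormedRing A] (a b : ℤ → A) : ℤ → A :=
  fun n => ∑' m : ℤ, a m * b (n - m)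

/-- The multiplicative unit `e` of the Wiener algebra: `e(0)=1`, `e(n)=0` for `n≠0`. -/
def wone {A : Type*} [NormedRing A] : ℤ → A := fun n => if n = 0 then 1 else 0

/-- `a` is a unit of the Wiener algebra `W(A)`. -/
def IsWienerUnit {A : Type*} [NormedRing A] (a : ℤ → A) : Prop :=
  RapidlyDecreasing a ∧ ∃ b : ℤ → A, RapidlyDecreasing b ∧ conv a b = wone

/-- `a` is strictly holomorphic: `a(0)=1` and `a(n)=0` for `n<0`. -/
def StrictlyHolomorphic {A : Type*} [NormedRing A] (a : ℤ → A) : Prop :=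
  a 0 = 1 ∧ ∀ n : ℤ, n < 0 → a n = 0

/-- `a` is strictly antiholomorphic: `a(0)=1` and `a(n)=0` for `n>0`. -/
def StrictlyAntiholomorphic {A : Type*} [NormedRing A] (a : ℤ → A) : Prop :=
  a 0 = 1 ∧ ∀ n : ℤ, 0 < n → a n = 0

/-- `a` is an orthogonal Laurent series: `a(n)·a(m)=0` whenever `n≠m`. -/
def OrthogonalSeq {A : Type*} [NormedRing A] (a : ℤ → A) : Prop :=
  ∀ n m : ℤ, n ≠ m → a n * a m = 0

theorem RapidlyDecreasing.summable_norm {A : Type*} [NormedRing A] {a : ℤ → A}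
    (ha : RapidlyDecreasing a) : Summable fun n : ℤ => ‖a n‖ := by
  obtain ⟨C, hC⟩ := ha 2
  have hs : Summable fun n : ℤ => C * (1 / (n : ℝ) ^ 2) :=
    (Real.summable_one_div_int_pow.2 one_lt_two).mul_left C
  refine hs.of_norm_bounded_eventually ?_
  filter_upwards [(Set.finite_singleton (0 : ℤ)).compl_mem_cofinite] with n hn
  have hn0 : (n : ℝ) ≠ 0 := by simpa using hn
  have hpos : 0 < (n : ℝ) ^ 2 := by positivity
  rw [norm_norm, mul_one_div, le_div_iff₀ hpos, mul_comm]
  refine le_trans ?_ (hC n)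
  gcongr ?_ * _
  rw [← sq_abs]
  gcongr
  linarith

theorem RapidlyDecreasing.comp_neg {A : Type*} [NormedRing A] {a : ℤ → A}
    (ha : RapidlyDecreasing a) : RapidlyDecreasing fun n => a (-n) := by
  intro k
  obtain ⟨C, hC⟩ := ha k
  exact ⟨C, fun n => by simpa using hC (-n)⟩

theorem RapidlyDecreasing.mul {A : Type*} [NormedRing A] {a b : ℤ → A}
    (ha : RapidlyDecreasing a) (hb : RapidlyDecreasing b) :
    RapidlyDecreasing fun n => a n * b n := by
  intro k
  obtain ⟨C, hC⟩ := ha k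
  obtain ⟨D, hD⟩ := hb 0
  refine ⟨C * D, fun n => ?_⟩
  have hDn : ‖b n‖ ≤ D := by simpa using hD n
  have hC0 : 0 ≤ C := le_trans (by positivity) (hC n)
  calc (1 + |(n : ℝ)|) ^ k * ‖a n * b n‖
      ≤ (1 + |(n : ℝ)|) ^ k * (‖a n‖ * ‖b n‖) := by
        gcongr
        exact norm_mul_le _ _
    _ = ((1 + |(n : ℝ)|) ^ k * ‖a n‖) * ‖b n‖ := by ring
    _ ≤ C * D := mul_le_mul (hC n) hDn (norm_nonneg _) hC0

theorem RapidlyDecreasing.summable {A : Type*} [NormedRing A] [CompleteSpace A] {a : ℤ → A}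
    (ha : RapidlyDecreasing a) : Summable a :=
  ha.summable_norm.of_norm

theorem RapidlyDecreasing.summable_conv {A : Type*} [NormedRing A] [CompleteSpace A]
    {a b : ℤ → A} (ha : RapidlyDecreasing a) (hb : RapidlyDecreasing b) (n : ℤ) :
    Summable fun m => a m * b (n - m) := by
  obtain ⟨D, hD⟩ := hb 0
  refine (ha.summable_norm.mul_right D).of_norm_bounded fun m => (norm_mul_le _ _).trans ?_
  gcongr
  simpa using hD (n - m)

/-- Multiplying `a * b` by the value `a k` of an orthogonal `a` isolates one term. -/
theorem OrthogonalSeq.mul_conv {A : Type*} [NormedRing A] [CompleteSpace A] {a b : ℤ → A}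
    (ha : RapidlyDecreasing a) (hb : RapidlyDecreasing b) (horth : OrthogonalSeq a) (k n : ℤ) :
    a k * conv a b n = a k * (a k * b (n - k)) := by
  rw [conv, ← (ha.summable_conv hb n).tsum_mul_left]
  refine tsum_eq_single k fun m hm => ?_
  rw [← mul_assoc, horth k m hm.symm, zero_mul]

/-- An orthogonal unit `a` of `W(A)` with idempotent family
`P n = a(n)·b(−n)` decomposes uniquely as a unit constant `a(1) = ∑_n a(n)` times the
orthonormal unit `N = P` of `W(A)`. -/
theorem orthogonal_unit_decomposition {A : Type*} [NormedCommRing A] [NormedAlgebra ℂ A]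
    [CompleteSpace A] (a b : ℤ → A)
    (ha : RapidlyDecreasing a) (horth : OrthogonalSeq a)
    (hb : RapidlyDecreasing b) (hab : conv a b = wone) :
    (Summable fun n : ℤ => ‖a n‖) ∧
    IsUnit (∑' n : ℤ, a n) ∧
    (RapidlyDecreasing (fun n : ℤ => a n * b (-n)) ∧
      (∃ c : ℤ → A, RapidlyDecreasing c ∧ conv (fun n : ℤ => a n * b (-n)) c = wone) ∧
      OrthogonalSeq (fun n : ℤ => a n * b (-n)) ∧
      (∑' n : ℤ, a n * b (-n)) = 1) ∧
    (∀ n : ℤ, a n = (∑' m : ℤ, a m) * (a n * b (-n))) ∧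
    (∀ (u : A) (M : ℤ → A), IsUnit u → RapidlyDecreasing M → OrthogonalSeq M →
      (∑' n : ℤ, M n) = 1 → (∀ n : ℤ, a n = u * M n) →
      u = ∑' n : ℤ, a n ∧ ∀ n : ℤ, M n = a n * b (-n)) := by
  have hsq (k : ℤ) : a k * (a k * b (-k)) = a k := by
    simpa [hab, wone] using (horth.mul_conv ha hb k 0).symm
  have hmixed (k j : ℤ) (hj : j ≠ -k) : a k * b j = 0 := by
    have h := horth.mul_conv ha hb k (j + k)
    have hne : j + k ≠ 0 := fun h0 => hj (eq_neg_of_add_eq_zero_left h0)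
    rw [hab, wone, if_neg hne, mul_zero, add_sub_cancel_right] at h
    calc a k * b j = a k * (a k * b (-k)) * b j := by rw [hsq]
      _ = b (-k) * (a k * (a k * b j)) := by ring
      _ = 0 := by rw [← h, mul_zero]
  have hsum : ∑' n : ℤ, a n * b (-n) = 1 := by
    simpa [conv, wone] using congrFun hab 0
  have hP : RapidlyDecreasing fun n : ℤ => a n * b (-n) := ha.mul hb.comp_neg
  have hPorth : OrthogonalSeq fun n : ℤ => a n * b (-n) := fun n m hnm => by
    rw [mul_mul_mul_comm, horth n m hnm, zero_mul]
  have hidem (n : ℤ) : a n * b (-n) * (a n * b (-n)) = a n * b (-n) := by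
    calc a n * b (-n) * (a n * b (-n)) = a n * (a n * b (-n)) * b (-n) := by ring
      _ = a n * b (-n) := by rw [hsq]
  have hdecomp (n : ℤ) : a n = (∑' m : ℤ, a m) * (a n * b (-n)) := by
    rw [← ha.summable.tsum_mul_right, tsum_eq_single n, hsq]
    intro m hm
    rw [← mul_assoc, horth m n hm, zero_mul]
  refine ⟨ha.summable_norm, ?_, ⟨hP, ⟨fun n => a (-n) * b (- -n), hP.comp_neg, ?_⟩, hPorth, hsum⟩,
    hdecomp, ?_⟩
  · refine IsUnit.of_mul_eq_one (∑' j : ℤ, b j) ?_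
    rw [← ha.summable.tsum_mul_right, ← hsum]
    refine tsum_congr fun k => ?_
    rw [← hb.summable.tsum_mul_left]
    exact tsum_eq_single (-k) (hmixed k)
  · funext n
    simp only [conv, wone]
    split_ifs with hn
    · subst hn
      rw [← hsum]
      refine tsum_congr fun m => ?_
      simpa using hidem m
    · rw [← tsum_zero (α := A) (β := ℤ)]
      refine tsum_congr fun m => hPorth m (-(n - m)) fun h => hn ?_
      omega
  · intro u M hu hM _ hM1 haM
    have hua : u = ∑' n : ℤ, a n := by
      rw [tsum_congr haM, hM.summable.tsum_mul_left, hM1, mul_one]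
    refine ⟨hua, fun n => hu.mul_left_cancel ?_⟩
    rw [← haM n]
    rw [hua]
    exact hdecomp n
end

section
/- Let A be a commutative complex Banach algebra with unit. Suppose a₁ and a₂ are units of the Wiener algebra W(A) with factorizations aᵢ = aᵢ⁻ * ãᵢ * aᵢ⁺ (i = 1,2), where each aᵢ⁻ is a strictly antiholomorphic unit, each ãᵢ is an orthogonal unit, and each aᵢ⁺ is a strictly holomorphic unit of W(A). Then a₁*a₂ = (a₁⁻*a₂⁻) * (ã₁*ã₂) * (a₁⁺*a₂⁺) is a factorization of the same type: a₁⁻*a₂⁻ is a strictly antiholomorphic unit, ã₁*ã₂ is an orthogonal unit, and a₁⁺*a₂⁺ is a strictly holomorphic unit of W(A). Consequently, the three component maps of the Wiener–Hopf factorization are group homomorphisms on the unit group of W(A). -/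
open scoped BigOperators

theorem summable_one_div_one_add_abs_int_sq :
    Summable fun n : ℤ => 1 / (1 + |(n : ℝ)|) ^ 2 := by
  have h : Summable fun n : ℕ => 1 / (1 + (n : ℝ)) ^ 2 := by
    have := (summable_nat_add_iff 1).2 (Real.summable_one_div_nat_pow.2 one_lt_two)
    simpa [add_comm] using this
  refine Summable.of_nat_of_neg ?_ ?_ <;> simpa using h

namespace RapidlyDecreasing

variable {A : Type*} [NormedRing A] {a b : ℤ → A}

theorem summable_pow_mul_norm (ha : RapidlyDecreasing a) (k : ℕ) :
    Summable fun n : ℤ => (1 + |(n : ℝ)|) ^ k * ‖a n‖ := by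
  obtain ⟨C, hC⟩ := ha (k + 2)
  refine Summable.of_nonneg_of_le (fun n => by positivity) (fun n => ?_)
    (summable_one_div_one_add_abs_int_sq.mul_left C)
  have hpos : 0 < (1 + |(n : ℝ)|) ^ 2 := by positivity
  rw [mul_one_div, le_div_iff₀ hpos]
  exact (le_of_eq (by ring)).trans (hC n)

theorem summable_norm_s11 (ha : RapidlyDecreasing a) : Summable fun n => ‖a n‖ := by
  simpa using ha.summable_pow_mul_norm 0

theorem exists_norm_le (ha : RapidlyDecreasing a) : ∃ C : ℝ, ∀ n, ‖a n‖ ≤ C := by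
  simpa using ha 0

theorem summable_norm_conv_terms (ha : RapidlyDecreasing a) (hb : RapidlyDecreasing b) (n : ℤ) :
    Summable fun m => ‖a m * b (n - m)‖ := by
  obtain ⟨C, hC⟩ := hb.exists_norm_le
  refine Summable.of_nonneg_of_le (fun m => norm_nonneg _) (fun m => ?_)
    (ha.summable_norm_s11.mul_right C)
  exact (norm_mul_le _ _).trans (by gcongr; exact hC _)

theorem conv (ha : RapidlyDecreasing a) (hb : RapidlyDecreasing b) :
    RapidlyDecreasing (conv a b) := by
  intro k
  obtain ⟨C, hC⟩ := hb k
  have hs := (ha.summable_pow_mul_norm k).mul_right C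
  refine ⟨∑' m : ℤ, (1 + |(m : ℝ)|) ^ k * ‖a m‖ * C, fun n => ?_⟩
  have hn := ha.summable_norm_conv_terms hb n
  calc (1 + |(n : ℝ)|) ^ k * ‖_root_.conv a b n‖
      ≤ (1 + |(n : ℝ)|) ^ k * ∑' m, ‖a m * b (n - m)‖ := by
        gcongr; exact norm_tsum_le_tsum_norm hn
    _ = ∑' m, (1 + |(n : ℝ)|) ^ k * ‖a m * b (n - m)‖ := tsum_mul_left.symm
    _ ≤ _ := (hn.mul_left _).tsum_le_tsum (fun m => ?_) hs
  have hle : 1 + |(n : ℝ)| ≤ (1 + |(m : ℝ)|) * (1 + |((n - m : ℤ) : ℝ)|) := by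
    have h := abs_add_le (m : ℝ) (n - m)
    rw [add_sub_cancel] at h
    push_cast
    nlinarith [mul_nonneg (abs_nonneg (m : ℝ)) (abs_nonneg ((n : ℝ) - m))]
  calc (1 + |(n : ℝ)|) ^ k * ‖a m * b (n - m)‖
      ≤ ((1 + |(m : ℝ)|) * (1 + |((n - m : ℤ) : ℝ)|)) ^ k * (‖a m‖ * ‖b (n - m)‖) := by
        gcongr; exact norm_mul_le _ _
    _ = (1 + |(m : ℝ)|) ^ k * ‖a m‖ * ((1 + |((n - m : ℤ) : ℝ)|) ^ k * ‖b (n - m)‖) := by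
        rw [mul_pow, mul_mul_mul_comm]
    _ ≤ _ := by gcongr; exact hC _

end RapidlyDecreasing

theorem rapidlyDecreasing_wone {A : Type*} [NormedRing A] :
    RapidlyDecreasing (wone : ℤ → A) := by
  refine fun k => ⟨‖(1 : A)‖, fun n => ?_⟩
  by_cases hn : n = 0 <;> simp [wone, hn]

theorem wone_conv {A : Type*} [NormedRing A] (a : ℤ → A) : conv wone a = a := by
  funext n
  rw [conv, tsum_eq_single 0 fun m hm => by simp [wone, hm]]
  simp [wone]

theorem conv_comm {A : Type*} [NormedCommRing A] (a b : ℤ → A) : conv a b = conv b a := by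
  funext n
  rw [conv, ← (Equiv.subLeft n).tsum_eq]
  simp [conv, mul_comm]

theorem conv_assoc {A : Type*} [NormedRing A] [CompleteSpace A] {a b c : ℤ → A}
    (ha : RapidlyDecreasing a) (hb : RapidlyDecreasing b) (hc : RapidlyDecreasing c) :
    conv (conv a b) c = conv a (conv b c) := by
  funext n
  obtain ⟨C, hC⟩ := hc.exists_norm_le
  have hab : Summable fun p : ℤ × ℤ => ‖a p.1‖ * ‖b (p.2 - p.1)‖ := by
    have h := ha.summable_norm_s11.mul_of_nonneg hb.summable_norm_s11
      (fun _ => norm_nonneg _) (fun _ => norm_nonneg _)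
    let e : ℤ × ℤ ≃ ℤ × ℤ := Equiv.prodShear (Equiv.refl ℤ) fun j => Equiv.subRight j
    exact (e.summable_iff (f := fun p : ℤ × ℤ => ‖a p.1‖ * ‖b p.2‖)).2 h
  have habc : Summable (Function.uncurry fun j m : ℤ => a j * b (m - j) * c (n - m)) := by
    refine Summable.of_norm_bounded (hab.mul_right C) fun p => ?_
    refine (norm_mul_le _ _).trans ?_
    gcongr
    · exact norm_mul_le _ _
    · exact hC _
  calc conv (conv a b) c n = ∑' m, ∑' j, a j * b (m - j) * c (n - m) :=
        tsum_congr fun m => ((ha.summable_norm_conv_terms hb m).of_norm.tsum_mul_right _).symm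
    _ = ∑' j, ∑' m, a j * b (m - j) * c (n - m) := habc.tsum_comm
    _ = ∑' j, ∑' m, a j * (b m * c (n - j - m)) := tsum_congr fun j => by
        rw [← (Equiv.addRight j).tsum_eq]
        simp [mul_assoc, sub_sub, add_comm]
    _ = conv a (conv b c) n := tsum_congr fun j =>
        (hb.summable_norm_conv_terms hc (n - j)).of_norm.tsum_mul_left _

/-- The multiplicative monoid of rapidly decreasing sequences, with convolution as product. -/
def WienerMonoid (A : Type*) [NormedRing A] : Type _ := {a : ℤ → A // RapidlyDecreasing a}

noncomputable instance {A : Type*} [NormedCommRing A] [CompleteSpace A] :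
    CommMonoid (WienerMonoid A) where
  mul a b := ⟨conv a.1 b.1, a.2.conv b.2⟩
  one := ⟨wone, rapidlyDecreasing_wone⟩
  mul_assoc a b c := Subtype.ext (conv_assoc a.2 b.2 c.2)
  mul_comm a b := Subtype.ext (conv_comm a.1 b.1)
  one_mul a := Subtype.ext (wone_conv a.1)
  mul_one a := Subtype.ext ((conv_comm a.1 wone).trans (wone_conv a.1))

theorem conv_conv_conv_comm {A : Type*} [NormedCommRing A] [CompleteSpace A] {a b c d : ℤ → A}
    (ha : RapidlyDecreasing a) (hb : RapidlyDecreasing b) (hc : RapidlyDecreasing c)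
    (hd : RapidlyDecreasing d) :
    conv (conv a b) (conv c d) = conv (conv a c) (conv b d) :=
  congrArg Subtype.val
    (mul_mul_mul_comm (G := WienerMonoid A) ⟨a, ha⟩ ⟨b, hb⟩ ⟨c, hc⟩ ⟨d, hd⟩)

theorem IsWienerUnit.conv {A : Type*} [NormedCommRing A] [CompleteSpace A] {a b : ℤ → A}
    (ha : IsWienerUnit a) (hb : IsWienerUnit b) : IsWienerUnit (conv a b) := by
  obtain ⟨ha, a', ha', haa'⟩ := ha
  obtain ⟨hb, b', hb', hbb'⟩ := hb
  exact ⟨ha.conv hb, _, ha'.conv hb', by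
    rw [conv_conv_conv_comm ha hb ha' hb', haa', hbb', wone_conv]⟩

theorem StrictlyHolomorphic.conv {A : Type*} [NormedRing A] {a b : ℤ → A}
    (ha : StrictlyHolomorphic a) (hb : StrictlyHolomorphic b) :
    StrictlyHolomorphic (conv a b) := by
  constructor
  · rw [_root_.conv, tsum_eq_single 0 fun m hm => ?_]
    · simp [ha.1, hb.1]
    · rcases hm.lt_or_gt with h | h
      · rw [ha.2 m h, zero_mul]
      · rw [hb.2 _ (by omega), mul_zero]
  · intro n hn
    refine (tsum_congr fun m => ?_).trans tsum_zero
    rcases lt_or_ge m 0 with h | h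
    · rw [ha.2 m h, zero_mul]
    · rw [hb.2 _ (by omega), mul_zero]

theorem StrictlyAntiholomorphic.conv {A : Type*} [NormedRing A] {a b : ℤ → A}
    (ha : StrictlyAntiholomorphic a) (hb : StrictlyAntiholomorphic b) :
    StrictlyAntiholomorphic (conv a b) := by
  constructor
  · rw [_root_.conv, tsum_eq_single 0 fun m hm => ?_]
    · simp [ha.1, hb.1]
    · rcases hm.lt_or_gt with h | h
      · rw [hb.2 _ (by omega), mul_zero]
      · rw [ha.2 m h, zero_mul]
  · intro n hn
    refine (tsum_congr fun m => ?_).trans tsum_zero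
    rcases lt_or_ge 0 m with h | h
    · rw [ha.2 m h, zero_mul]
    · rw [hb.2 _ (by omega), mul_zero]

theorem OrthogonalSeq.conv {A : Type*} [NormedCommRing A] [CompleteSpace A] {a b : ℤ → A}
    (ha : OrthogonalSeq a) (hb : OrthogonalSeq b)
    (hra : RapidlyDecreasing a) (hrb : RapidlyDecreasing b) :
    OrthogonalSeq (conv a b) := by
  intro n m hnm
  have hs := fun n => (hra.summable_norm_conv_terms hrb n).of_norm
  rw [_root_.conv, _root_.conv, ← (hs n).tsum_mul_right]
  refine (tsum_congr fun j => ?_).trans tsum_zero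
  rw [← (hs m).tsum_mul_left]
  refine (tsum_congr fun k => ?_).trans tsum_zero
  rw [mul_mul_mul_comm]
  by_cases hjk : j = k
  · rw [hb _ _ (by omega), mul_zero]
  · rw [ha _ _ hjk, zero_mul]

/-- Wiener–Hopf factorizations multiply componentwise: if
`aᵢ = aᵢ⁻ * ãᵢ * aᵢ⁺` are factorizations into a strictly antiholomorphic unit, an
orthogonal unit and a strictly holomorphic unit, then
`a₁*a₂ = (a₁⁻*a₂⁻) * (ã₁*ã₂) * (a₁⁺*a₂⁺)` is again such a factorization; hence the
three component maps are group homomorphisms on the unit group of `W(A)`. -/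
theorem wiener_hopf_multiplicative {A : Type*} [NormedCommRing A] [NormedAlgebra ℂ A]
    [CompleteSpace A]
    (a₁ a₂ a₁m t₁ a₁p a₂m t₂ a₂p : ℤ → A)
    (h₁m : IsWienerUnit a₁m) (h₁m' : StrictlyAntiholomorphic a₁m)
    (h₁t : IsWienerUnit t₁) (h₁t' : OrthogonalSeq t₁)
    (h₁p : IsWienerUnit a₁p) (h₁p' : StrictlyHolomorphic a₁p)
    (h₂m : IsWienerUnit a₂m) (h₂m' : StrictlyAntiholomorphic a₂m)
    (h₂t : IsWienerUnit t₂) (h₂t' : OrthogonalSeq t₂)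
    (h₂p : IsWienerUnit a₂p) (h₂p' : StrictlyHolomorphic a₂p)
    (ha₁ : a₁ = conv a₁m (conv t₁ a₁p))
    (ha₂ : a₂ = conv a₂m (conv t₂ a₂p)) :
    conv a₁ a₂ = conv (conv a₁m a₂m) (conv (conv t₁ t₂) (conv a₁p a₂p)) ∧
    IsWienerUnit (conv a₁m a₂m) ∧ StrictlyAntiholomorphic (conv a₁m a₂m) ∧
    IsWienerUnit (conv t₁ t₂) ∧ OrthogonalSeq (conv t₁ t₂) ∧
    IsWienerUnit (conv a₁p a₂p) ∧ StrictlyHolomorphic (conv a₁p a₂p) := by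
  subst ha₁ ha₂
  refine ⟨?_, h₁m.conv h₂m, h₁m'.conv h₂m', h₁t.conv h₂t, h₁t'.conv h₂t' h₁t.1 h₂t.1,
    h₁p.conv h₂p, h₁p'.conv h₂p'⟩
  rw [conv_conv_conv_comm h₁m.1 (h₁t.1.conv h₁p.1) h₂m.1 (h₂t.1.conv h₂p.1),
    conv_conv_conv_comm h₁t.1 h₁p.1 h₂t.1 h₂p.1]
end
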